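/- Let H[1],…,H[K] ∈ ℂ^{N_r×N_t} and R = (1/K) Σ_{k=1}^K H[k]* H[k]. Suppose F_RF ∈ ℂ^{N_t×N_RF} is such that the column space of F_RF contains the column space of R. Then for every k = 1,…,K and every fully-digital precoder W ∈ ℂ^{N_t×S}, there exists a baseband precoder F_BB ∈ ℂ^{N_RF×S} with H[k] F_RF F_BB = H[k] W; that is, the hybrid architecture can realize the action of any fully-digital precoder on every subcarrier channel. -/

import Mathlib

open Matrix BigOperators

/-- The kernel of the covariance is contained in the kernel of each channel. -/
theorem aux_ker (K Nr Nt : ℕ) (hK : 0 < K)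
    (H : Fin K → Matrix (Fin Nr) (Fin Nt) ℂ) (v : Fin Nt → ℂ)
    (hv : ((K : ℂ)⁻¹ • ∑ k, (H k)ᴴ * H k) *ᵥ v = 0) (k : Fin K) : H k *ᵥ v = 0 := by
  have hK' : (K : ℂ)⁻¹ ≠ 0 := inv_ne_zero (by exact_mod_cast hK.ne')
  rw [Matrix.smul_mulVec, smul_eq_zero, or_iff_right hK', Matrix.sum_mulVec] at hv
  have h2 : ∑ j, ∑ i, ‖(H j *ᵥ v) i‖ ^ 2 = (0 : ℝ) := by
    have h1 := congrArg (fun u => star v ⬝ᵥ u) hv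
    simp only [dotProduct_sum, dotProduct_zero] at h1
    have h3 : ∀ j, star v ⬝ᵥ (((H j)ᴴ * H j) *ᵥ v)
        = ((∑ i, ‖(H j *ᵥ v) i‖ ^ 2 : ℝ) : ℂ) := by
      intro j
      rw [← Matrix.mulVec_mulVec, Matrix.dotProduct_mulVec, ← Matrix.star_mulVec]
      simp only [dotProduct, Pi.star_apply, RCLike.star_def]
      push_cast
      exact Finset.sum_congr rfl fun i _ => Complex.conj_mul' _
    simp only [h3] at h1
    exact_mod_cast h1
  have h4 := (Finset.sum_eq_zero_iff_of_nonneg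
    (fun j _ => Finset.sum_nonneg fun i _ => sq_nonneg _)).1 h2 k (Finset.mem_univ _)
  ext i
  have h5 := (Finset.sum_eq_zero_iff_of_nonneg (fun i _ => sq_nonneg _)).1 h4 i (Finset.mem_univ _)
  simpa using h5

/-- A Hermitian matrix has the same range as its square. -/
theorem aux_range (n : ℕ) (R : Matrix (Fin n) (Fin n) ℂ) (hR : Rᴴ = R) (w : Fin n → ℂ) :
    ∃ x, R *ᵥ (R *ᵥ x) = R *ᵥ w := by
  have h1 : LinearMap.range (R * R).mulVecLin ≤ LinearMap.range R.mulVecLin := by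
    rw [Matrix.mulVecLin_mul]
    exact LinearMap.range_comp_le_range _ _
  have h2 : (R * R).rank = R.rank := by
    have := open scoped ComplexOrder in Matrix.rank_conjTranspose_mul_self R
    rwa [hR] at this
  have h3 := Submodule.eq_of_le_of_finrank_eq h1 h2
  have h4 : R *ᵥ w ∈ LinearMap.range (R * R).mulVecLin := by
    rw [h3]; exact ⟨w, rfl⟩
  obtain ⟨x, hx⟩ := h4
  exact ⟨x, by simpa [Matrix.mulVec_mulVec] using hx⟩

/-- If the column space of the analog precoder `F_RF` contains the column
space of `R = (1/K) ∑ₖ H[k]ᴴ H[k]`, then on every subcarrier `k` the hybrid architecture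
can realize the action of any fully-digital precoder `W`: there is a baseband precoder
`F_BB` with `H[k] F_RF F_BB = H[k] W`. -/
theorem stmt_6 (K Nr Nt NRF S : ℕ) (hK : 0 < K)
    (H : Fin K → Matrix (Fin Nr) (Fin Nt) ℂ)
    (R : Matrix (Fin Nt) (Fin Nt) ℂ)
    (hR : R = (K : ℂ)⁻¹ • ∑ k, (H k)ᴴ * H k)
    (FRF : Matrix (Fin Nt) (Fin NRF) ℂ)
    (hrange : LinearMap.range R.mulVecLin ≤ LinearMap.range FRF.mulVecLin) :
    ∀ k, ∀ W : Matrix (Fin Nt) (Fin S) ℂ,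
      ∃ FBB : Matrix (Fin NRF) (Fin S) ℂ, H k * (FRF * FBB) = H k * W := by
  intro k W
  have hH : Rᴴ = R := by
    simp [hR, Matrix.conjTranspose_smul, Matrix.conjTranspose_sum, Matrix.conjTranspose_mul]
  have key : ∀ w : Fin Nt → ℂ, ∃ y : Fin NRF → ℂ, H k *ᵥ (FRF *ᵥ y) = H k *ᵥ w := by
    intro w
    obtain ⟨x, hx⟩ := aux_range Nt R hH w
    obtain ⟨y, hy⟩ := hrange (⟨x, rfl⟩ : R *ᵥ x ∈ LinearMap.range R.mulVecLin)
    refine ⟨y, ?_⟩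
    have hy' : FRF *ᵥ y = R *ᵥ x := hy
    have h0 : R *ᵥ (R *ᵥ x - w) = 0 := by rw [Matrix.mulVec_sub, hx, sub_self]
    have h1 := aux_ker K Nr Nt hK H (R *ᵥ x - w) (hR ▸ h0) k
    rw [hy']
    rwa [Matrix.mulVec_sub, sub_eq_zero] at h1
  choose f hf using key
  refine ⟨Matrix.of fun i s => f (fun j => W j s) i, ?_⟩
  ext i s
  exact congrFun (hf (fun j => W j s)) i
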